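/- arXiv:2101.09319 — 2 statements merged into one kernel-verified Lean document; each statement's English description precedes it below -/
import Mathlib

section
/- Let n ≥ 1 and let α be a chord diagram of order n whose interlacement graph is connected, and suppose g(α, A) = g(α, ∅) for every set A of chords of α. If the chords {x, α x} and {y, α y} interlace, then the unordered pair of orbits of ρ ∘ α containing y and α y coincides with the unordered pair of orbits containing x and α x; that is, any edge-ribbon interlaced with a given edge-ribbon e is attached to the same two face-discs as e. -/
open scoped Classical

/-- The first point of `S` among `y + 1, y + 2, …` (equal to `y` if no such point exists). -/
noncomputable def firstAfter (n : ℕ) (S : Set (ZMod (2 * n))) (y : ZMod (2 * n)) : ZMod (2 * n) :=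
  if h : ∃ k : ℕ, 0 < k ∧ y + (k : ZMod (2 * n)) ∈ S then y + (Nat.find h : ZMod (2 * n)) else y

/-- One step of the boundary permutation `π_A` of the endpoint set `S`:
`x ∈ S` goes to the first point of `S` among `α x + 1, α x + 2, …`. -/
def boundaryStep (n : ℕ) (α : Equiv.Perm (ZMod (2 * n))) (S : Set (ZMod (2 * n)))
    (x y : ZMod (2 * n)) : Prop :=
  x ∈ S ∧ y = firstAfter n S (α x)

/-- `c(A)`: the number of orbits of `π_A` on the endpoint set `S`, with `c(∅) = 1`. -/
noncomputable def orbitCount (n : ℕ) (α : Equiv.Perm (ZMod (2 * n))) (S : Set (ZMod (2 * n))) : ℕ :=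
  if S = ∅ then 1
  else ((fun x => {y | Relation.EqvGen (boundaryStep n α S) x y}) '' S).ncard

/-- The genus `g(α, A) = (2 + n − c(A) − c(Aᶜ))/2` of the partial dual relative to the
set of chords with endpoint set `S`. -/
noncomputable def pdGenus (n : ℕ) (α : Equiv.Perm (ZMod (2 * n))) (S : Set (ZMod (2 * n))) : ℕ :=
  (2 + n - orbitCount n α S - orbitCount n α Sᶜ) / 2

/-- The chords `{x, α x}` and `{y, α y}` interlace: writing `α x = x + m`, exactly one of
`y, α y` lies in the cyclic interval `{x + k : 1 ≤ k ≤ m − 1}`. -/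
def Interlaces (n : ℕ) (α : Equiv.Perm (ZMod (2 * n))) (x y : ZMod (2 * n)) : Prop :=
  Xor' (0 < (y - x).val ∧ (y - x).val < (α x - x).val)
       (0 < (α y - x).val ∧ (α y - x).val < (α x - x).val)

/-- The interlacement graph of `α`: vertices are the chords, adjacency is interlacement. -/
def interGraph (n : ℕ) (α : Equiv.Perm (ZMod (2 * n))) :
    SimpleGraph {p : Sym2 (ZMod (2 * n)) // ∃ x, p = s(x, α x)} :=
  SimpleGraph.fromRel (fun c d => ∃ x y, c.1 = s(x, α x) ∧ d.1 = s(y, α y) ∧ Interlaces n α x y)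

/-- The partial-dual genus polynomial `∂Γ_α(z) = Σ_{A ⊆ chords} z^{g(α,A)}`, the sum running
over the α-invariant endpoint sets. -/
noncomputable def pdPoly (n : ℕ) (hn : n ≠ 0) (α : Equiv.Perm (ZMod (2 * n))) : Polynomial ℕ :=
  haveI : NeZero (2 * n) := ⟨by omega⟩
  ∑ S : Finset (ZMod (2 * n)),
    if (∀ x ∈ S, α x ∈ S) then Polynomial.X ^ pdGenus n α (↑S) else 0

/-- The face permutation `ρ ∘ α : x ↦ α x + 1`, whose orbits are the faces of the
one-vertex ribbon graph of `α`. -/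
def faceMap (n : ℕ) (α : Equiv.Perm (ZMod (2 * n))) : Equiv.Perm (ZMod (2 * n)) :=
  α.trans (Equiv.addRight 1)

/-- The face (orbit of `ρ ∘ α`) containing a point `z`. -/
def faceOrbit (n : ℕ) (α : Equiv.Perm (ZMod (2 * n))) (z : ZMod (2 * n)) : Set (ZMod (2 * n)) :=
  {w | (faceMap n α).SameCycle z w}

/-- The number of faces of the one-vertex ribbon graph of `α`:
the number of orbits of `ρ ∘ α`. -/
noncomputable def numFaces (n : ℕ) (α : Equiv.Perm (ZMod (2 * n))) : ℕ :=
  (Set.range (faceOrbit n α)).ncard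

/-- The chord diagram `B_n`: the involution `x ↦ x + n` of `ZMod (2n)`, all of whose
chords are pairwise interlacing. -/
def bn (n : ℕ) : Equiv.Perm (ZMod (2 * n)) :=
  Equiv.addRight (n : ZMod (2 * n))

/-- Number of cycles (fixed points included). -/
noncomputable def cyc {V : Type*} (τ : Equiv.Perm V) : ℕ :=
  Nat.card (Quotient (Equiv.Perm.SameCycle.setoid τ))

theorem samecycle_sub {V : Type*} (τ : Equiv.Perm V) (r : Setoid V)
    (h : ∀ c, r c (τ c)) {c d : V} (hcd : τ.SameCycle c d) : r c d := by
  obtain ⟨i, rfl⟩ := hcd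
  induction i using Int.induction_on with
  | zero => exact r.refl _
  | succ i ih =>
    refine r.trans ih ?_
    have := h ((τ ^ (i : ℤ)) c)
    rwa [← Equiv.Perm.mul_apply, ← zpow_one_add, add_comm] at this
  | pred i ih =>
    refine r.trans ih ?_
    have := h ((τ ^ (-(i : ℤ) - 1)) c)
    rw [← Equiv.Perm.mul_apply, ← zpow_one_add] at this
    have e : 1 + (-(i : ℤ) - 1) = -i := by ring
    rw [e] at this
    exact r.symm this

theorem step_sc {V : Type*} (τ : Equiv.Perm V) (c : V) : τ.SameCycle c (τ c) := ⟨1, by simp⟩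

theorem merge_same {V : Type*} [Finite V] [DecidableEq V] (τ : Equiv.Perm V) (a b : V)
    (h : ¬ τ.SameCycle a b) : (τ * Equiv.swap a b).SameCycle a b := by
  have hex : ∃ k, 0 < k ∧ (τ ^ k) b = b := by
    refine ⟨orderOf τ, orderOf_pos τ, by simp [pow_orderOf_eq_one]⟩
  have key : ∀ j, j + 1 ≤ Nat.find hex →
      ((τ * Equiv.swap a b) ^ (j + 1)) a = (τ ^ (j + 1)) b := by
    intro j
    induction j with
    | zero => intro _; simp
    | succ j ih =>
      intro hj
      rw [pow_succ', Equiv.Perm.mul_apply, ih (by omega), pow_succ' τ (j + 1),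
        Equiv.Perm.mul_apply, Equiv.Perm.mul_apply, Equiv.swap_apply_of_ne_of_ne]
      · intro e
        exact h (Equiv.Perm.SameCycle.symm ⟨((j + 1 : ℕ) : ℤ), by rw [zpow_natCast]; exact e⟩)
      · intro e
        exact Nat.find_min hex (m := j + 1) (by omega) ⟨by omega, e⟩
  have hs := Nat.find_spec hex
  have := key (Nat.find hex - 1) (by omega)
  rw [Nat.sub_add_cancel hs.1, hs.2] at this
  exact ⟨(Nat.find hex : ℕ), by simpa using this⟩

theorem split_not_same {V : Type*} [Finite V] [DecidableEq V] (τ : Equiv.Perm V) (a b : V)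
    (hab : a ≠ b) (h : τ.SameCycle a b) : ¬ (τ * Equiv.swap a b).SameCycle a b := by
  have hex : ∃ k, 0 < k ∧ (τ ^ k) a = b := by
    obtain ⟨k, hk, -, e⟩ := h.exists_pow_eq''
    exact ⟨k, hk, e⟩
  set k := Nat.find hex with hk
  have hs := Nat.find_spec hex
  have hmin : ∀ i, 0 < i → i < k → (τ ^ i) a ≠ b := fun i h0 hi e =>
    Nat.find_min hex hi ⟨h0, e⟩
  have hna : ∀ i, 0 < i → i ≤ k → (τ ^ i) a ≠ a := by
    intro i h0 hi e
    rcases hi.eq_or_lt with rfl | hlt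
    · exact hab (e.symm.trans hs.2)
    · refine hmin (k - i) (by omega) (by omega) ?_
      have : (τ ^ (k - i + i)) a = b := by rw [Nat.sub_add_cancel hi]; exact hs.2
      rwa [pow_add, Equiv.Perm.mul_apply, e] at this
  have inv : ∀ m, ∃ i, 0 < i ∧ i ≤ k ∧ ((τ * Equiv.swap a b) ^ m) b = (τ ^ i) a := by
    intro m
    induction m with
    | zero => exact ⟨k, hs.1, le_rfl, by simpa using hs.2.symm⟩
    | succ m ih =>
      obtain ⟨i, h0, hi, e⟩ := ih
      rw [pow_succ', Equiv.Perm.mul_apply, e]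
      rcases hi.eq_or_lt with rfl | hlt
      · refine ⟨1, one_pos, hs.1, ?_⟩
        rw [hs.2]; simp
      · refine ⟨i + 1, by omega, by omega, ?_⟩
        rw [Equiv.Perm.mul_apply, Equiv.swap_apply_of_ne_of_ne (hna i h0 hi) (hmin i h0 hlt),
          pow_succ' τ, Equiv.Perm.mul_apply]
  intro hc
  obtain ⟨m, -, -, e⟩ := hc.symm.exists_pow_eq''
  obtain ⟨i, h0, hi, e'⟩ := inv m
  exact hna i h0 hi (e'.symm.trans e)

theorem merge_iff {V : Type*} [Finite V] [DecidableEq V] (τ : Equiv.Perm V) (a b : V)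
    (h : ¬ τ.SameCycle a b) (c d : V) :
    (τ * Equiv.swap a b).SameCycle c d ↔ τ.SameCycle c d ∨
      (τ.SameCycle c a ∧ τ.SameCycle d b) ∨ (τ.SameCycle c b ∧ τ.SameCycle d a) := by
  have hm := merge_same τ a b h
  have sub : ∀ {c d}, τ.SameCycle c d → (τ * Equiv.swap a b).SameCycle c d := by
    intro c d hcd
    refine samecycle_sub τ (Equiv.Perm.SameCycle.setoid (τ * Equiv.swap a b)) ?_ hcd
    intro c
    change (τ * Equiv.swap a b).SameCycle c (τ c)
    by_cases hca : c = a
    · subst hca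
      refine hm.trans ?_
      have := step_sc (τ * Equiv.swap c b) b
      simpa using this
    by_cases hcb : c = b
    · subst hcb
      refine hm.symm.trans ?_
      have := step_sc (τ * Equiv.swap a c) a
      simpa using this
    have := step_sc (τ * Equiv.swap a b) c
    rwa [Equiv.Perm.mul_apply, Equiv.swap_apply_of_ne_of_ne hca hcb] at this
  constructor
  · intro hcd
    let J : Setoid V :=
      { r := fun c d => τ.SameCycle c d ∨
          (τ.SameCycle c a ∧ τ.SameCycle d b) ∨ (τ.SameCycle c b ∧ τ.SameCycle d a)
        iseqv := by
          refine ⟨fun c => Or.inl (Equiv.Perm.SameCycle.refl _ _), ?_, ?_⟩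
          · rintro c d (h | ⟨h1, h2⟩ | ⟨h1, h2⟩)
            · exact Or.inl h.symm
            · exact Or.inr (Or.inr ⟨h2, h1⟩)
            · exact Or.inr (Or.inl ⟨h2, h1⟩)
          · rintro c d e (h | ⟨h1, h2⟩ | ⟨h1, h2⟩) (h' | ⟨h1', h2'⟩ | ⟨h1', h2'⟩)
            · exact Or.inl (h.trans h')
            · exact Or.inr (Or.inl ⟨h.trans h1', h2'⟩)
            · exact Or.inr (Or.inr ⟨h.trans h1', h2'⟩)
            · exact Or.inr (Or.inl ⟨h1, h'.symm.trans h2⟩)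
            · exact absurd (h1'.symm.trans h2) h
            · exact Or.inl (h1.trans h2'.symm)
            · exact Or.inr (Or.inr ⟨h1, h'.symm.trans h2⟩)
            · exact Or.inl (h1.trans h2'.symm)
            · exact absurd (h2.symm.trans h1') h }
    refine samecycle_sub _ J ?_ hcd
    intro c
    change τ.SameCycle c _ ∨ (τ.SameCycle c a ∧ τ.SameCycle _ b) ∨
      (τ.SameCycle c b ∧ τ.SameCycle _ a)
    by_cases hca : c = a
    · subst hca
      refine Or.inr (Or.inl ⟨Equiv.Perm.SameCycle.refl _ _, ?_⟩)
      simpa using (step_sc τ b).symm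
    by_cases hcb : c = b
    · subst hcb
      refine Or.inr (Or.inr ⟨Equiv.Perm.SameCycle.refl _ _, ?_⟩)
      simpa using (step_sc τ a).symm
    rw [Equiv.Perm.mul_apply, Equiv.swap_apply_of_ne_of_ne hca hcb]
    exact Or.inl (step_sc τ c)
  · rintro (h | ⟨h1, h2⟩ | ⟨h1, h2⟩)
    · exact sub h
    · exact (sub h1).trans (hm.trans (sub h2).symm)
    · exact (sub h1).trans (hm.symm.trans (sub h2).symm)

theorem cyc_merge {V : Type*} [Finite V] [DecidableEq V] (τ : Equiv.Perm V) (a b : V)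
    (h : ¬ τ.SameCycle a b) : cyc (τ * Equiv.swap a b) + 1 = cyc τ := by
  let R := Equiv.Perm.SameCycle.setoid τ
  let R' := Equiv.Perm.SameCycle.setoid (τ * Equiv.swap a b)
  have sub : ∀ {c d}, τ.SameCycle c d → (τ * Equiv.swap a b).SameCycle c d :=
    fun hcd => (merge_iff τ a b h _ _).2 (Or.inl hcd)
  let f : Quotient R → Quotient R' := Quotient.map id (fun c d hcd => sub hcd)
  let qb : Quotient R := Quotient.mk R b
  have bij : Function.Bijective (fun q : {q : Quotient R // q ≠ qb} => f q.1) := by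
    constructor
    · rintro ⟨p, hp⟩ ⟨q, hq⟩ e
      induction p using Quotient.inductionOn with | _ c
      induction q using Quotient.inductionOn with | _ d
      apply Subtype.ext
      have hp' : ¬ τ.SameCycle c b := fun e => hp (Quotient.sound e)
      have hq' : ¬ τ.SameCycle d b := fun e => hq (Quotient.sound e)
      have e' : (τ * Equiv.swap a b).SameCycle c d := Quotient.exact e
      rw [merge_iff τ a b h] at e'
      apply Quotient.sound
      change τ.SameCycle c d
      tauto
    · intro q
      induction q using Quotient.inductionOn with | _ c
      by_cases hc : τ.SameCycle c b
      · refine ⟨⟨Quotient.mk R a, fun e => h (Quotient.exact e)⟩, ?_⟩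
        apply Quotient.sound
        change (τ * Equiv.swap a b).SameCycle a c
        exact (merge_iff τ a b h _ _).2 (Or.inr (Or.inl ⟨Equiv.Perm.SameCycle.refl _ _, hc⟩))
      · exact ⟨⟨Quotient.mk R c, fun e => hc (Quotient.exact e)⟩, rfl⟩
  have h1 : Nat.card {q : Quotient R // q ≠ qb} = Nat.card (Quotient R') :=
    Nat.card_congr (Equiv.ofBijective _ bij)
  have h2 : Nat.card {q : Quotient R // q ≠ qb} + 1 = Nat.card (Quotient R) := by
    have := Set.ncard_compl ({qb} : Set (Quotient R))
    have hpos : 0 < Nat.card (Quotient R) :=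
      have : Nonempty (Quotient R) := ⟨qb⟩
      Nat.card_pos
    rw [Set.ncard_singleton] at this
    have e : ({qb} : Set (Quotient R))ᶜ.ncard = Nat.card {q : Quotient R // q ≠ qb} := rfl
    omega
  change Nat.card (Quotient R') + 1 = Nat.card (Quotient R)
  omega

theorem cyc_split {V : Type*} [Finite V] [DecidableEq V] (τ : Equiv.Perm V) (a b : V)
    (hab : a ≠ b) (h : τ.SameCycle a b) : cyc (τ * Equiv.swap a b) = cyc τ + 1 := by
  have := cyc_merge (τ * Equiv.swap a b) a b (split_not_same τ a b hab h)
  rw [mul_assoc, Equiv.swap_mul_self, mul_one] at this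
  exact this.symm

/-- `τ` is `ρ` composed with `α` restricted to `S`. -/
def IsTau (n : ℕ) (α : Equiv.Perm (ZMod (2 * n))) (S : Set (ZMod (2 * n)))
    (τ : Equiv.Perm (ZMod (2 * n))) : Prop :=
  (∀ z ∈ S, τ z = α z + 1) ∧ (∀ z, z ∉ S → τ z = z + 1)

theorem walk (n : ℕ) (α : Equiv.Perm (ZMod (2 * n))) (S : Set (ZMod (2 * n)))
    (τ : Equiv.Perm (ZMod (2 * n))) (hτ : IsTau n α S τ) (u w : ZMod (2 * n))
    (hu : τ u = w + 1) (k : ℕ) (hk : ∀ i : ℕ, 0 < i → i < k → w + (i : ZMod (2 * n)) ∉ S)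
    (h0 : 0 < k) : (τ ^ k) u = w + (k : ZMod (2 * n)) := by
  induction k with
  | zero => omega
  | succ k ih =>
    rcases Nat.eq_zero_or_pos k with rfl | hpos
    · simpa using hu
    · rw [pow_succ', Equiv.Perm.mul_apply, ih (fun i a b => hk i a (by omega)) hpos,
        hτ.2 _ (hk k hpos (by omega))]
      push_cast; ring

theorem exists_reach (n : ℕ) (hn : 1 ≤ n) (S : Set (ZMod (2 * n))) (s w : ZMod (2 * n))
    (hs : s ∈ S) : ∃ k : ℕ, 0 < k ∧ w + (k : ZMod (2 * n)) ∈ S := by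
  haveI : NeZero (2 * n) := ⟨by omega⟩
  refine ⟨(s - w).val + 2 * n, by omega, ?_⟩
  have : ((2 * n : ℕ) : ZMod (2 * n)) = 0 := ZMod.natCast_self _
  rw [Nat.cast_add, this, ZMod.natCast_val, ZMod.cast_id', id, add_zero, add_sub_cancel]
  exact hs

theorem orbitCount_eq (n : ℕ) (hn : 1 ≤ n) (α : Equiv.Perm (ZMod (2 * n)))
    (S : Set (ZMod (2 * n)))
    (τ : Equiv.Perm (ZMod (2 * n))) (hτ : IsTau n α S τ) : orbitCount n α S = cyc τ := by
  haveI : NeZero (2 * n) := ⟨by omega⟩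
  unfold orbitCount
  split_ifs with hS
  · subst hS
    have all : ∀ c d, τ.SameCycle c d := by
      intro c d
      obtain ⟨k, hk, e⟩ := exists_reach n hn {d} d c rfl
      refine ⟨(k : ℕ), ?_⟩
      rw [zpow_natCast, walk n α ∅ τ hτ c c (hτ.2 c (by simp)) k (by simp) hk]
      exact e
    symm
    unfold cyc
    rw [Nat.card_eq_one_iff_unique]
    refine ⟨⟨fun p q => ?_⟩, ⟨Quotient.mk _ 0⟩⟩
    induction p using Quotient.inductionOn with | _ c
    induction q using Quotient.inductionOn with | _ d
    exact Quotient.sound (all c d)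
  · obtain ⟨s, hs⟩ := Set.nonempty_iff_ne_empty.2 hS
    -- one step
    have stepk : ∀ x ∈ S, ∃ k : ℕ, 0 < k ∧ (τ ^ k) x = firstAfter n S (α x) ∧
        firstAfter n S (α x) ∈ S ∧ ∀ i : ℕ, 0 < i → i < k → (τ ^ i) x ∉ S := by
      intro x hx
      have hex := exists_reach n hn S s (α x) hs
      have hsp := Nat.find_spec hex
      have hmin : ∀ i : ℕ, 0 < i → i < Nat.find hex → α x + (i : ZMod (2 * n)) ∉ S :=
        fun i h0 hi hm => Nat.find_min hex hi ⟨h0, hm⟩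
      refine ⟨Nat.find hex, hsp.1, ?_, ?_, ?_⟩
      · rw [walk n α S τ hτ x (α x) (hτ.1 x hx) _ hmin hsp.1, firstAfter, dif_pos hex]
      · rw [firstAfter, dif_pos hex]; exact hsp.2
      · intro i h0 hi
        rw [walk n α S τ hτ x (α x) (hτ.1 x hx) i (fun j a b => hmin j a (by omega)) h0]
        exact hmin i h0 hi
    have fwd : ∀ x y, Relation.EqvGen (boundaryStep n α S) x y → τ.SameCycle x y := by
      intro x y hxy
      induction hxy with
      | rel x y h =>
        obtain ⟨hx, rfl⟩ := h
        obtain ⟨k, -, e, -⟩ := stepk x hx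
        exact ⟨(k : ℕ), by simpa using e⟩
      | refl x => exact Equiv.Perm.SameCycle.refl _ _
      | symm x y _ ih => exact ih.symm
      | trans x y z _ _ i1 i2 => exact i1.trans i2
    have bwd : ∀ m : ℕ, ∀ x ∈ S, (τ ^ m) x ∈ S →
        Relation.EqvGen (boundaryStep n α S) x ((τ ^ m) x) := by
      intro m
      induction m using Nat.strong_induction_on with
      | _ m ih =>
        intro x hx hy
        rcases Nat.eq_zero_or_pos m with rfl | hpos
        · exact Relation.EqvGen.refl _
        obtain ⟨k, hk, e, hS', hmin⟩ := stepk x hx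
        have hkm : k ≤ m := by
          by_contra hlt
          exact hmin m hpos (by omega) hy
        have e2 : (τ ^ m) x = (τ ^ (m - k)) (firstAfter n S (α x)) := by
          rw [← e, ← Equiv.Perm.mul_apply, ← pow_add, Nat.sub_add_cancel hkm]
        refine Relation.EqvGen.trans _ (firstAfter n S (α x)) _
          (Relation.EqvGen.rel _ _ ⟨hx, rfl⟩) ?_
        rw [e2] at hy ⊢
        exact ih (m - k) (by omega) _ hS' hy
    have iff : ∀ x ∈ S, ∀ y ∈ S, (Relation.EqvGen (boundaryStep n α S) x y ↔
        τ.SameCycle x y) := by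
      intro x hx y hy
      refine ⟨fwd x y, fun h => ?_⟩
      obtain ⟨m, -, -, rfl⟩ := h.exists_pow_eq''
      exact bwd m x hx hy
    have meet : ∀ z, ∃ x ∈ S, τ.SameCycle x z := by
      intro z
      by_cases hz : z ∈ S
      · exact ⟨z, hz, Equiv.Perm.SameCycle.refl _ _⟩
      have hex := exists_reach n hn S s z hs
      have hsp := Nat.find_spec hex
      refine ⟨_, hsp.2, Equiv.Perm.SameCycle.symm ⟨(Nat.find hex : ℕ), ?_⟩⟩
      rw [zpow_natCast]
      exact walk n α S τ hτ z z (hτ.2 z hz) _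
        (fun i h0 hi hm => Nat.find_min hex hi ⟨h0, hm⟩) hsp.1
    choose p hpS hp using meet
    set f : ZMod (2 * n) → Set (ZMod (2 * n)) :=
      fun x => {y | Relation.EqvGen (boundaryStep n α S) x y} with hf
    have feq : ∀ x ∈ S, ∀ y ∈ S, (f x = f y ↔ τ.SameCycle x y) := by
      intro x hx y hy
      rw [← iff x hx y hy]
      constructor
      · intro h
        have : y ∈ f y := Relation.EqvGen.refl _
        rw [← h] at this
        exact this
      · intro h
        ext z
        exact ⟨fun h' => (h.symm).trans _ _ _ h', fun h' => h.trans _ _ _ h'⟩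
    let g : Quotient (Equiv.Perm.SameCycle.setoid τ) → (f '' S) :=
      Quotient.lift (fun z => (⟨f (p z), p z, hpS z, rfl⟩ : (f '' S))) (by
        intro c d hcd
        have hcd' : τ.SameCycle c d := hcd
        apply Subtype.ext
        exact (feq _ (hpS c) _ (hpS d)).2 ((hp c).trans (hcd'.trans (hp d).symm)))
    have gb : Function.Bijective g := by
      constructor
      · intro c d e
        induction c using Quotient.inductionOn with | _ c
        induction d using Quotient.inductionOn with | _ d
        have e' : f (p c) = f (p d) := congrArg Subtype.val e
        rw [feq _ (hpS c) _ (hpS d)] at e'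
        apply Quotient.sound
        exact (hp c).symm.trans (e'.trans (hp d))
      · rintro ⟨_, x, hx, rfl⟩
        refine ⟨Quotient.mk _ x, Subtype.ext ?_⟩
        exact (feq _ (hpS x) _ hx).2 (hp x)
    exact (Nat.card_congr (Equiv.ofBijective g gb)).symm

theorem isTau_remove (n : ℕ) (α : Equiv.Perm (ZMod (2 * n)))
    (hinv : ∀ x, α (α x) = x) (S : Set (ZMod (2 * n)))
    (τ : Equiv.Perm (ZMod (2 * n))) (hτ : IsTau n α S τ) (x : ZMod (2 * n)) (hx : x ∈ S)
    (hx' : α x ∈ S) : IsTau n α (S \ {x, α x}) (τ * Equiv.swap x (α x)) := by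
  have A : ∀ z, z ≠ x → z ≠ α x → (τ * Equiv.swap x (α x)) z = τ z := by
    intro z h1 h2
    rw [Equiv.Perm.mul_apply, Equiv.swap_apply_of_ne_of_ne h1 h2]
  constructor
  · rintro z ⟨hz, hz'⟩
    simp only [Set.mem_insert_iff, Set.mem_singleton_iff, not_or] at hz'
    rw [A z hz'.1 hz'.2, hτ.1 z hz]
  · intro z hz
    by_cases h1 : z = x
    · subst h1
      rw [Equiv.Perm.mul_apply, Equiv.swap_apply_left, hτ.1 _ hx', hinv]
    by_cases h2 : z = α x
    · subst h2
      rw [Equiv.Perm.mul_apply, Equiv.swap_apply_right, hτ.1 _ hx]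
    rw [A z h1 h2]
    apply hτ.2
    intro h
    exact hz ⟨h, by simp [h1, h2]⟩

theorem isTau_insert (n : ℕ) (α : Equiv.Perm (ZMod (2 * n)))
    (hinv : ∀ x, α (α x) = x) (S : Set (ZMod (2 * n)))
    (τ : Equiv.Perm (ZMod (2 * n))) (hτ : IsTau n α S τ) (x : ZMod (2 * n)) (hx : x ∉ S)
    (hx' : α x ∉ S) : IsTau n α (S ∪ {x, α x}) (τ * Equiv.swap x (α x)) := by
  have A : ∀ z, z ≠ x → z ≠ α x → (τ * Equiv.swap x (α x)) z = τ z := by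
    intro z h1 h2
    rw [Equiv.Perm.mul_apply, Equiv.swap_apply_of_ne_of_ne h1 h2]
  constructor
  · intro z hz
    by_cases h1 : z = x
    · subst h1
      rw [Equiv.Perm.mul_apply, Equiv.swap_apply_left, hτ.2 _ hx']
    by_cases h2 : z = α x
    · subst h2
      rw [Equiv.Perm.mul_apply, Equiv.swap_apply_right, hτ.2 _ hx, hinv]
    rw [A z h1 h2]
    apply hτ.1
    rcases hz with h | h
    · exact h
    · simp [h1, h2] at h
  · intro z hz
    simp only [Set.mem_union, Set.mem_insert_iff, Set.mem_singleton_iff, not_or] at hz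
    rw [A z hz.2.1 hz.2.2, hτ.2 z hz.1]

theorem isTau_empty (n : ℕ) (α : Equiv.Perm (ZMod (2 * n))) :
    IsTau n α ∅ (Equiv.addRight 1) := ⟨by simp, by simp⟩

theorem isTau_univ (n : ℕ) (α : Equiv.Perm (ZMod (2 * n))) :
    IsTau n α Set.univ (faceMap n α) := ⟨by simp [faceMap], by simp⟩

theorem cyc_bound (n : ℕ) (hn : 1 ≤ n) (α : Equiv.Perm (ZMod (2 * n)))
    (hinv : ∀ x, α (α x) = x) (hfree : ∀ x, α x ≠ x) :
    ∀ (N : ℕ) (S : Set (ZMod (2 * n))) (τ : Equiv.Perm (ZMod (2 * n))),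
      (∀ x ∈ S, α x ∈ S) → IsTau n α S τ → S.ncard = N → 2 * cyc τ ≤ N + 2 := by
  haveI : NeZero (2 * n) := ⟨by omega⟩
  intro N
  induction N using Nat.strong_induction_on with
  | _ N ih =>
    intro S τ hS hτ hN
    by_cases hE : S = ∅
    · have := orbitCount_eq n hn α S τ hτ
      rw [orbitCount, if_pos hE] at this
      omega
    obtain ⟨x, hx⟩ := Set.nonempty_iff_ne_empty.2 hE
    have hx' := hS x hx
    have hsub : ({x, α x} : Set (ZMod (2 * n))) ⊆ S := by
      rintro z (rfl | rfl) <;> assumption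
    have hc : (S \ {x, α x}).ncard + 2 = N := by
      have := Set.ncard_sdiff_add_ncard_of_subset hsub
      rw [Set.ncard_pair (hfree x).symm] at this
      omega
    have := ih (S \ {x, α x}).ncard (by omega) (S \ {x, α x}) _ (by
      rintro z ⟨hz, hz'⟩
      simp only [Set.mem_insert_iff, Set.mem_singleton_iff, not_or] at hz'
      refine ⟨hS z hz, ?_⟩
      simp only [Set.mem_insert_iff, Set.mem_singleton_iff, not_or]
      refine ⟨fun e => hz'.2 ?_, fun e => hz'.1 (α.injective e)⟩
      rw [← e, hinv]) (isTau_remove n α hinv S τ hτ x hx hx') rfl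
    have : cyc τ ≤ cyc (τ * Equiv.swap x (α x)) + 1 := by
      by_cases h : τ.SameCycle x (α x)
      · have := cyc_split τ x (α x) (hfree x).symm h
        omega
      · have := cyc_merge τ x (α x) h
        omega
    omega

theorem arc_not_same (n : ℕ) (hn : 1 ≤ n) (x x' u v : ZMod (2 * n)) (hxx' : x' ≠ x)
    (hu : 0 < (u - x).val ∧ (u - x).val ≤ (x' - x).val)
    (hv : ¬ (0 < (v - x).val ∧ (v - x).val ≤ (x' - x).val)) :
    ¬ ((Equiv.addRight (1 : ZMod (2 * n))) * Equiv.swap x x').SameCycle u v := by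
  haveI : NeZero (2 * n) := ⟨by omega⟩
  haveI : Fact (1 < 2 * n) := ⟨by omega⟩
  intro h
  obtain ⟨m, -, -, rfl⟩ := h.exists_pow_eq''
  apply hv
  clear hv h
  have hpos : 0 < (x' - x).val := by
    rw [Nat.pos_iff_ne_zero, Ne, ZMod.val_eq_zero, sub_eq_zero]; exact hxx'
  induction m with
  | zero => simpa using hu
  | succ m ih =>
    rw [pow_succ', Equiv.Perm.mul_apply]
    generalize (((Equiv.addRight (1 : ZMod (2 * n))) * Equiv.swap x x') ^ m) u = z at ih
    by_cases hz : z = x'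
    · subst hz
      rw [Equiv.Perm.mul_apply, Equiv.swap_apply_right, Equiv.coe_addRight, add_sub_cancel_left,
        ZMod.val_one]
      omega
    have hzx : z ≠ x := by
      rintro rfl
      simp at ih
    rw [Equiv.Perm.mul_apply, Equiv.swap_apply_of_ne_of_ne hzx hz, Equiv.coe_addRight]
    have hne : (z - x).val ≠ (x' - x).val := by
      intro e
      exact hz (sub_left_injective (ZMod.val_injective _ e))
    have hlt := ZMod.val_lt (x' - x)
    have : (z + 1 - x).val = (z - x).val + 1 := by
      have e : z + 1 - x = (z - x) + 1 := by ring
      rw [e, ZMod.val_add_of_lt, ZMod.val_one]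
      rw [ZMod.val_one]; omega
    change 0 < (z + 1 - x).val ∧ (z + 1 - x).val ≤ (x' - x).val
    rw [this]
    omega

/-- **Lemma, part (2)**: under the same hypotheses, any chord interlaced with the chord
`{x, α x}` is attached to the same unordered pair of face-discs (orbits of `ρ ∘ α`). -/
theorem interlaced_same_faces (n : ℕ) (hn : 1 ≤ n) (α : Equiv.Perm (ZMod (2 * n)))
    (hinv : ∀ x, α (α x) = x) (hfree : ∀ x, α x ≠ x)
    (hconn : (interGraph n α).Connected)
    (hgenus : ∀ S : Set (ZMod (2 * n)), (∀ x ∈ S, α x ∈ S) →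
      pdGenus n α S = pdGenus n α ∅)
    (x y : ZMod (2 * n)) (hdistinct : y ≠ x ∧ y ≠ α x)
    (hint : Interlaces n α x y) :
    ({faceOrbit n α y, faceOrbit n α (α y)} : Set (Set (ZMod (2 * n)))) =
      {faceOrbit n α x, faceOrbit n α (α x)} := by
  haveI : NeZero (2 * n) := ⟨by omega⟩
  have hgu : pdGenus n α ∅ = (2 + n - 1 - cyc (faceMap n α)) / 2 := by
    rw [pdGenus, Set.compl_empty, orbitCount_eq n hn α _ _ (isTau_univ n α), orbitCount, if_pos rfl]
  have c0 : cyc (Equiv.addRight (1 : ZMod (2 * n))) = 1 := by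
    rw [← orbitCount_eq n hn α _ _ (isTau_empty n α), orbitCount, if_pos rfl]
  have s0 : ∀ c d, (Equiv.addRight (1 : ZMod (2 * n))).SameCycle c d := by
    intro c d
    have h1 : Nat.card (Quotient (Equiv.Perm.SameCycle.setoid
      (Equiv.addRight (1 : ZMod (2 * n))))) = 1 := c0
    rw [Nat.card_eq_one_iff_unique] at h1
    haveI := h1.1
    exact Quotient.exact (Subsingleton.elim
      (Quotient.mk (Equiv.Perm.SameCycle.setoid (Equiv.addRight (1 : ZMod (2 * n)))) c)
      (Quotient.mk _ d))
  have c1 : ∀ x, cyc ((Equiv.addRight (1 : ZMod (2 * n))) * Equiv.swap x (α x)) = 2 := by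
    intro x
    rw [cyc_split _ _ _ (hfree x).symm (s0 _ _), c0]
  have t1 : ∀ x, IsTau n α {x, α x} ((Equiv.addRight (1 : ZMod (2 * n))) * Equiv.swap x (α x)) := by
    intro x
    have := isTau_insert n α hinv ∅ _ (isTau_empty n α) x (by simp) (by simp)
    rwa [Set.empty_union] at this
  have t1' : ∀ x, IsTau n α ({x, α x}ᶜ) (faceMap n α * Equiv.swap x (α x)) := by
    intro x
    have := isTau_remove n α hinv _ _ (isTau_univ n α) x (by simp) (by simp)
    rwa [← Set.compl_eq_univ_sdiff] at this
  have cardu : (Set.univ : Set (ZMod (2 * n))).ncard = 2 * n := by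
    rw [Set.ncard_univ, Nat.card_zmod]
  have inv1 : ∀ x, ∀ z ∈ ({x, α x} : Set (ZMod (2 * n))), α z ∈ ({x, α x} : Set (ZMod (2 * n))) := by
    rintro x z (rfl | rfl)
    · simp
    · simp [hinv]
  have hF := cyc_bound n hn α hinv hfree _ _ _ (by simp) (isTau_univ n α) cardu
  -- every chord touches two distinct faces
  have distinct : ∀ x, ¬ (faceMap n α).SameCycle x (α x) := by
    intro x hsame
    have hc := cyc_split _ _ _ (hfree x).symm hsame
    have hb := cyc_bound n hn α hinv hfree _ _ _ (by
      intro z hz hz'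
      exact hz (by simpa [hinv] using inv1 x _ hz')) (t1' x) rfl
    have hcard : ({x, α x}ᶜ : Set (ZMod (2 * n))).ncard + 2 = 2 * n := by
      have := Set.ncard_add_ncard_compl ({x, α x} : Set (ZMod (2 * n)))
      rw [Set.ncard_pair (hfree x).symm, Nat.card_zmod] at this
      omega
    have hg := hgenus {x, α x} (inv1 x)
    rw [hgu, pdGenus, orbitCount_eq n hn α _ _ (t1 x), orbitCount_eq n hn α _ _ (t1' x), c1 x] at hg
    omega
  obtain ⟨hyx, hyx'⟩ := hdistinct
  have hy1 : α y ≠ x := fun e => hyx' (by rw [← e, hinv])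
  have hy2 : α y ≠ α x := fun e => hyx (α.injective e)
  have arcne : ¬ ((Equiv.addRight (1 : ZMod (2 * n))) * Equiv.swap x (α x)).SameCycle y (α y) := by
    have e1 : (y - x).val ≠ (α x - x).val := fun e =>
      hyx' (sub_left_injective (ZMod.val_injective _ e))
    have e2 : (α y - x).val ≠ (α x - x).val := fun e =>
      hy2 (sub_left_injective (ZMod.val_injective _ e))
    rcases hint with ⟨h1, h2⟩ | ⟨h1, h2⟩
    · exact arc_not_same n hn x (α x) y (α y) (hfree x) (by omega) (by omega)
    · exact fun h => arc_not_same n hn x (α x) (α y) y (hfree x) (by omega) (by omega) h.symm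
  have c2 := cyc_merge _ _ _ arcne
  rw [c1 x] at c2
  have t2 := isTau_insert n α hinv _ _ (t1 x) y (by simp [hyx, hyx']) (by simp [hy1, hyx])
  have t2' := isTau_remove n α hinv _ _ (t1' x) y (by simp [hyx, hyx']) (by simp [hy1, hyx])
  have hset : ({x, α x}ᶜ \ {y, α y} : Set (ZMod (2 * n))) = ({x, α x} ∪ {y, α y})ᶜ := by
    rw [Set.compl_union, Set.sdiff_eq]
  rw [hset] at t2'
  have hg := hgenus ({x, α x} ∪ {y, α y}) (by
    rintro z (hz | hz)
    · exact Or.inl (inv1 x z hz)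
    · exact Or.inr (inv1 y z hz))
  rw [hgu, pdGenus, orbitCount_eq n hn α _ _ t2, orbitCount_eq n hn α _ _ t2'] at hg
  have m1 := cyc_merge _ _ _ (distinct x)
  have hsame : (faceMap n α * Equiv.swap x (α x)).SameCycle y (α y) := by
    by_contra hns
    have m2 := cyc_merge _ _ _ hns
    omega
  rw [merge_iff _ _ _ (distinct x)] at hsame
  have fo : ∀ {c d}, (faceMap n α).SameCycle c d → faceOrbit n α c = faceOrbit n α d := by
    intro c d h
    ext z
    exact ⟨fun h' => h.symm.trans h', fun h' => h.trans h'⟩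
  rcases hsame with h | ⟨h1, h2⟩ | ⟨h1, h2⟩
  · exact absurd h (distinct y)
  · rw [fo h1, fo h2]
  · rw [fo h1, fo h2, Set.pair_comm]
end

section
/- Let n be odd, n ≥ 1, and let α_n be the involution x ↦ x + n of ZMod (2n) (the chord diagram B_n). Then for every set A of chords of B_n one has g(B_n, A) = (n − 1)/2; that is, every partial dual of B_n has genus (n − 1)/2, and the partial-dual genus polynomial of B_n is ∂Γ_{B_n}(z) = 2^n · z^{(n−1)/2} (Yan–Jin's family of counterexamples to the Gross–Mansour–Tucker conjecture). -/
open scoped Classical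

lemma yj_count_not (p : ℕ → Prop) (m : ℕ) :
    Nat.count p m + Nat.count (fun j => ¬ p j) m = m := by
  induction m with
  | zero => simp
  | succ m ih =>
    rw [Nat.count_succ, Nat.count_succ]
    by_cases h : p m <;> simp [h] <;> omega

lemma yj_count_add (p : ℕ → Prop) (n : ℕ) (hp : ∀ m, p (m + n) ↔ p m) (m : ℕ) :
    Nat.count p (m + n) = Nat.count p m + Nat.count p n := by
  induction m with
  | zero => simp
  | succ m ih =>
    have : m + 1 + n = (m + n) + 1 := by ring
    rw [this, Nat.count_succ, Nat.count_succ, ih]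
    simp only [hp]
    split_ifs <;> omega

lemma yj_per {n : ℕ} {S : Set (ZMod (2 * n))} (hS : ∀ x ∈ S, bn n x ∈ S) (x : ZMod (2 * n)) :
    x + (n : ZMod (2 * n)) ∈ S ↔ x ∈ S := by
  constructor
  · intro h
    have h2 := hS _ h
    have : bn n (x + n) = x := by
      have h3 : ((2 * n : ℕ) : ZMod (2 * n)) = 0 := ZMod.natCast_self _
      push_cast at h3
      simp only [bn, Equiv.coe_addRight]
      linear_combination h3
    rwa [this] at h2
  · intro h; exact hS _ h

lemma yj_first {n : ℕ} {S : Set (ZMod (2 * n))}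
    (hinf : (setOf fun m : ℕ => (m : ZMod (2 * n)) ∈ S).Infinite) (a : ℕ) :
    firstAfter n S ((Nat.nth (fun m : ℕ => (m : ZMod (2 * n)) ∈ S) a : ℕ) : ZMod (2 * n)) =
      ((Nat.nth (fun m : ℕ => (m : ZMod (2 * n)) ∈ S) (a + 1) : ℕ) : ZMod (2 * n)) := by
  set T := fun m : ℕ => (m : ZMod (2 * n)) ∈ S with hT
  have hlt : Nat.nth T a < Nat.nth T (a + 1) := Nat.nth_strictMono hinf (Nat.lt_succ_self a)
  have hm : T (Nat.nth T (a + 1)) := Nat.nth_mem_of_infinite hinf _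
  have hex : ∃ k : ℕ, 0 < k ∧ ((Nat.nth T a : ℕ) : ZMod (2 * n)) + (k : ZMod (2 * n)) ∈ S := by
    refine ⟨Nat.nth T (a + 1) - Nat.nth T a, by omega, ?_⟩
    rw [← Nat.cast_add, Nat.add_sub_cancel' hlt.le]
    exact hm
  have hfind : Nat.find hex = Nat.nth T (a + 1) - Nat.nth T a := by
    rw [Nat.find_eq_iff]
    refine ⟨⟨by omega, ?_⟩, ?_⟩
    · rw [← Nat.cast_add, Nat.add_sub_cancel' hlt.le]
      exact hm
    · rintro j hj ⟨hj0, hjS⟩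
      rw [← Nat.cast_add] at hjS
      have hTj : T (Nat.nth T a + j) := hjS
      have h1 := Nat.nth_count hTj
      have h2 : Nat.nth T a < Nat.nth T (Nat.count T (Nat.nth T a + j)) := by rw [h1]; omega
      have h3 : Nat.nth T (Nat.count T (Nat.nth T a + j)) < Nat.nth T (a + 1) := by rw [h1]; omega
      rw [Nat.nth_lt_nth hinf] at h2 h3
      omega
  unfold firstAfter
  rw [dif_pos hex, hfind, ← Nat.cast_add, Nat.add_sub_cancel' hlt.le]

lemma yj_orbit {n : ℕ} (hn : 1 ≤ n) {S : Set (ZMod (2 * n))} (hS : ∀ x ∈ S, bn n x ∈ S) :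
    orbitCount n (bn n) S =
      if Odd (Nat.count (fun m : ℕ => (m : ZMod (2 * n)) ∈ S) n) then 2 else 1 := by
  haveI : NeZero (2 * n) := ⟨by omega⟩
  by_cases hE : S = ∅
  · subst hE
    simp [orbitCount, Nat.count_false]
  have hper : ∀ m : ℕ, ((m + n : ℕ) : ZMod (2 * n)) ∈ S ↔ (m : ZMod (2 * n)) ∈ S := by
    intro m
    rw [Nat.cast_add]
    exact yj_per hS _
  set T := fun m : ℕ => (m : ZMod (2 * n)) ∈ S with hT
  have hadd : ∀ m, Nat.count T (m + n) = Nat.count T m + Nat.count T n := yj_count_add T n hper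
  have hinf : (setOf T).Infinite := by
    obtain ⟨x, hx⟩ := Set.nonempty_iff_ne_empty.mpr hE
    have h : ∀ j : ℕ, T (x.val + j * n) := by
      intro j
      induction j with
      | zero => simpa [hT] using hx
      | succ j ih =>
        have : x.val + (j + 1) * n = (x.val + j * n) + n := by ring
        rw [this]
        exact (hper _).2 ih
    refine Set.infinite_of_injective_forall_mem (f := fun j : ℕ => x.val + j * n) ?_ h
    intro a b hab
    have : a * n = b * n := by simpa using hab
    exact Nat.eq_of_mul_eq_mul_right (by omega) this
  generalize hk : Nat.count T n = k at *
  have hmem : ∀ a, T (Nat.nth T a) := fun a => Nat.nth_mem_of_infinite hinf a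
  have hnth : ∀ a, Nat.nth T (a + k) = Nat.nth T a + n := by
    intro a
    have h1 : T (Nat.nth T a + n) := (hper _).2 (hmem a)
    have h2 := Nat.nth_count h1
    rwa [hadd, Nat.count_nth_of_infinite hinf] at h2
  have hstep : ∀ a, firstAfter n S (bn n (Nat.nth T a : ℕ)) = (Nat.nth T (a + k + 1) : ℕ) := by
    intro a
    have := yj_first hinf (a + k)
    rw [← this]
    show firstAfter n S ((Nat.nth T a : ℕ) + (n : ZMod (2 * n))) =
      firstAfter n S (Nat.nth T (a + k) : ℕ)
    rw [hnth, Nat.cast_add]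
  have hsurj : ∀ x ∈ S, ∃ a, x = (Nat.nth T a : ℕ) := by
    intro x hx
    have hx' : T x.val := by simpa [hT] using hx
    refine ⟨Nat.count T x.val, ?_⟩
    rw [Nat.nth_count hx']
    simp
  have hrel : ∀ a, Relation.EqvGen (boundaryStep n (bn n) S) (Nat.nth T a : ℕ)
      (Nat.nth T (a + k + 1) : ℕ) := fun a => .rel _ _ ⟨hmem a, (hstep a).symm⟩
  have hwrap : ∀ a, ((Nat.nth T (a + k + k) : ℕ) : ZMod (2 * n)) = (Nat.nth T a : ℕ) := by
    intro a
    have h3 : ((2 * n : ℕ) : ZMod (2 * n)) = 0 := ZMod.natCast_self _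
    push_cast at h3
    rw [hnth, hnth]
    push_cast
    linear_combination h3
  have hrel2 : ∀ a, Relation.EqvGen (boundaryStep n (bn n) S) (Nat.nth T a : ℕ)
      (Nat.nth T (a + 2) : ℕ) := by
    intro a
    have h := (hrel a).trans _ _ _ (hrel (a + k + 1))
    have e : a + k + 1 + k + 1 = (a + 2) + k + k := by ring
    rwa [e, hwrap] at h
  have hrelj : ∀ j a, Relation.EqvGen (boundaryStep n (bn n) S) (Nat.nth T a : ℕ)
      (Nat.nth T (a + 2 * j) : ℕ) := by
    intro j a
    induction j with
    | zero => exact .refl _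
    | succ j ih => exact ih.trans _ _ _ (hrel2 (a + 2 * j))
  set F := (fun x => {y | Relation.EqvGen (boundaryStep n (bn n) S) x y}) with hF
  have hFeq : ∀ x y, F x = F y ↔ Relation.EqvGen (boundaryStep n (bn n) S) x y := by
    intro x y
    constructor
    · intro h
      have : y ∈ F y := Relation.EqvGen.refl y
      rw [← h] at this
      exact this
    · intro h
      ext z
      exact ⟨fun hz => (h.symm _ _).trans _ _ _ hz, fun hz => h.trans _ _ _ hz⟩
  have himg : F '' S = {F (Nat.nth T 0 : ℕ), F (Nat.nth T 1 : ℕ)} := by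
    ext c
    constructor
    · rintro ⟨x, hx, rfl⟩
      obtain ⟨a, rfl⟩ := hsurj x hx
      rcases Nat.even_or_odd' a with ⟨j, rfl | rfl⟩
      · left
        rw [hFeq]
        have := hrelj j 0
        rw [Nat.zero_add] at this
        exact this.symm
      · right
        show F _ = F _
        rw [hFeq]
        have := hrelj j 1
        rw [Nat.add_comm] at this
        exact this.symm
    · rintro (rfl | rfl)
      · exact ⟨_, hmem 0, rfl⟩
      · exact ⟨_, hmem 1, rfl⟩
  have hoc : orbitCount n (bn n) S = (F '' S).ncard := by
    simp only [orbitCount, if_neg hE, hF]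
  rw [hoc, himg]
  split_ifs with hkodd
  · apply Set.ncard_pair
    rw [Ne, hFeq]
    intro hcon
    have hmod : ∀ q m : ℕ, Nat.count T (m + 2 * n * q) = Nat.count T m + 2 * k * q := by
      intro q m
      induction q with
      | zero => simp
      | succ q ih =>
        have : m + 2 * n * (q + 1) = m + 2 * n * q + n + n := by ring
        rw [this, hadd, hadd, ih]
        ring
    have hpar : ∀ a, (Nat.count T ((Nat.nth T a : ℕ) : ZMod (2 * n)).val) % 2 = a % 2 := by
      intro a
      rw [ZMod.val_natCast]
      have h1 := hmod (Nat.nth T a / (2 * n)) (Nat.nth T a % (2 * n))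
      rw [Nat.mod_add_div, Nat.count_nth_of_infinite hinf, Nat.mul_assoc] at h1
      omega
    have hinv : ∀ x y, Relation.EqvGen (boundaryStep n (bn n) S) x y →
        Nat.count T x.val % 2 = Nat.count T y.val % 2 := by
      intro x y h
      induction h with
      | rel x y h =>
        obtain ⟨hx, rfl⟩ := h
        obtain ⟨a, rfl⟩ := hsurj x hx
        rw [hstep, hpar, hpar]
        obtain ⟨r, hr⟩ := hkodd
        omega
      | refl x => rfl
      | symm x y _ ih => exact ih.symm
      | trans x y z _ _ ih1 ih2 => exact ih1.trans ih2
    have := hinv _ _ hcon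
    rw [hpar, hpar] at this
    omega
  · have hke : Even k := by simpa using hkodd
    obtain ⟨r, hr⟩ := hke
    have h01 : F (Nat.nth T 0 : ℕ) = F (Nat.nth T 1 : ℕ) := by
      rw [hFeq]
      have h1 := hrel 0
      have h2 := hrelj r 1
      have e : 0 + k + 1 = 1 + 2 * r := by omega
      rw [e] at h1
      exact h1.trans _ _ _ (h2.symm)
    rw [h01]
    simp

lemma yj_genus {n : ℕ} (hn : 1 ≤ n) (hodd : Odd n) (S : Set (ZMod (2 * n)))
    (hS : ∀ x ∈ S, bn n x ∈ S) : pdGenus n (bn n) S = (n - 1) / 2 := by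
  have hSc : ∀ x ∈ Sᶜ, bn n x ∈ Sᶜ := fun x hx h => hx ((yj_per hS x).1 h)
  have h := yj_count_not (fun m : ℕ => (m : ZMod (2 * n)) ∈ S) n
  have h2 : orbitCount n (bn n) Sᶜ =
      if Odd (Nat.count (fun j : ℕ => ¬ (j : ZMod (2 * n)) ∈ S) n) then 2 else 1 := by
    rw [yj_orbit hn hSc]
    congr!
  unfold pdGenus
  rw [yj_orbit hn hS, h2]
  obtain ⟨r, hr⟩ := hodd
  split_ifs with h3 h4 h4 <;> simp only [Nat.odd_iff] at h3 h4 <;> omega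

lemma yj_card {n : ℕ} (hn : 1 ≤ n) [NeZero (2 * n)] :
    (Finset.univ.filter fun S : Finset (ZMod (2 * n)) => ∀ x ∈ S, bn n x ∈ S).card = 2 ^ n := by
  have h2n : 2 ^ n = (Finset.range n).powerset.card := by simp
  rw [h2n]
  have hval : ∀ x : ZMod (2 * n), x = ((x.val % n : ℕ) : ZMod (2 * n)) ∨
      x = ((x.val % n : ℕ) : ZMod (2 * n)) + (n : ZMod (2 * n)) := by
    intro x
    have hlt := ZMod.val_lt x
    have hx : ((x.val : ℕ) : ZMod (2 * n)) = x := by simp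
    by_cases h : x.val < n
    · left
      rw [Nat.mod_eq_of_lt h, hx]
    · right
      rw [← Nat.cast_add]
      have : x.val % n + n = x.val := by
        rw [Nat.mod_eq_sub_mod (by omega), Nat.mod_eq_of_lt (by omega)]
        omega
      rw [this, hx]
  refine Finset.card_bij' (fun S _ => (Finset.range n).filter fun i : ℕ => (i : ZMod (2 * n)) ∈ S)
    (fun R _ => Finset.univ.filter fun x : ZMod (2 * n) => x.val % n ∈ R) ?_ ?_ ?_ ?_
  · intro S _
    simp
  · intro R _
    simp only [Finset.mem_filter, Finset.mem_univ, true_and]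
    intro x hx
    have : (bn n x).val % n = x.val % n := by
      simp only [bn, Equiv.coe_addRight]
      rw [ZMod.val_add, ZMod.val_natCast, Nat.mod_mod_of_dvd _ (Dvd.intro_left 2 rfl),
        Nat.add_mod, Nat.mod_mod_of_dvd _ (Dvd.intro_left 2 rfl)]
      simp
    rwa [this]
  · intro S hS
    simp only [Finset.mem_filter, Finset.mem_univ, true_and] at hS
    ext x
    have hp := yj_per (S := (S : Set (ZMod (2 * n)))) (by simpa using hS)
      ((x.val % n : ℕ) : ZMod (2 * n))
    simp only [Finset.mem_coe] at hp
    simp only [Finset.mem_filter, Finset.mem_univ, true_and, Finset.mem_range,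
      Nat.mod_lt _ (show 0 < n by omega)]
    rcases hval x with h | h
    · rw [← h]
    · rw [← h] at hp
      exact hp.symm
  · intro R hR
    rw [Finset.mem_powerset] at hR
    ext i
    simp only [Finset.mem_filter, Finset.mem_univ, true_and, Finset.mem_range]
    constructor
    · rintro ⟨hi, h⟩
      rwa [ZMod.val_natCast, Nat.mod_eq_of_lt (show i < 2 * n by omega), Nat.mod_eq_of_lt hi] at h
    · intro h
      have hi := Finset.mem_range.1 (hR h)
      refine ⟨hi, ?_⟩
      rwa [ZMod.val_natCast, Nat.mod_eq_of_lt (show i < 2 * n by omega), Nat.mod_eq_of_lt hi]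


/-- **Yan–Jin**: for odd `n`, every partial dual of `B_n` has genus `(n − 1)/2`, and the
partial-dual genus polynomial of `B_n` is `2^n · z^{(n−1)/2}` — a family of
counterexamples to the Gross–Mansour–Tucker conjecture. -/
theorem YanJin_Bn_odd (n : ℕ) (hn : 1 ≤ n) (hodd : Odd n) :
    (∀ S : Set (ZMod (2 * n)), (∀ x ∈ S, bn n x ∈ S) →
      pdGenus n (bn n) S = (n - 1) / 2) ∧
    pdPoly n (by omega) (bn n) =
      Polynomial.C ((2 : ℕ) ^ n) * Polynomial.X ^ ((n - 1) / 2) := by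
  refine ⟨fun S hS => yj_genus hn hodd S hS, ?_⟩
  haveI : NeZero (2 * n) := ⟨by omega⟩
  unfold pdPoly
  have h : ∀ S : Finset (ZMod (2 * n)),
      (if (∀ x ∈ S, bn n x ∈ S) then (Polynomial.X : Polynomial ℕ) ^ pdGenus n (bn n) (↑S) else 0) =
      if (∀ x ∈ S, bn n x ∈ S) then (Polynomial.X : Polynomial ℕ) ^ ((n - 1) / 2) else 0 := by
    intro S
    split_ifs with hS
    · rw [yj_genus hn hodd _ (by simpa using hS)]
    · rfl
  rw [Finset.sum_congr rfl (fun S _ => h S), ← Finset.sum_filter, Finset.sum_const, yj_card hn]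
  simp
end
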